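/- (Proposition 1, inequality (16)) Let d ≥ 2, n = d+1, and fix nonnegative integers ℓ₁, ℓ₂ with ℓ := ℓ₁+ℓ₂ < d. For any symmetrical code that satisfies node regeneration, message recovery (for parameter ℓ), and repair secrecy (for parameters ℓ₁, ℓ₂), and for every m ∈ [ℓ+1:d], one has (1/(d−ℓ)) · H(U^{(ℓ₁,ℓ+1)}) ≥ Σ_{j=ℓ+1}^{m} T_{d,j,ℓ}^{−1} B_j + T_{d,m,ℓ}^{−1} · H(U^{(ℓ₁,m)} | M_{[ℓ+1:m]}) + (1/(d−ℓ) − T_{d,m,ℓ}^{−1}) · H(U^{(ℓ₁,ℓ)}). -/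

import Mathlib

open scoped BigOperators Classical

namespace MDCSR

noncomputable section

/-- `X` is a deterministic function of `Y`. -/
def IsFuncOf {Ω α β : Type*} (X : Ω → α) (Y : Ω → β) : Prop :=
  ∃ f : β → α, ∀ ω, X ω = f (Y ω)

variable {Ω V : Type} [Fintype Ω]

/-- Probability of the event `X = x` under the probability mass function `p`. -/
def pm (p : Ω → ℝ) {α : Type*} (X : Ω → α) (x : α) : ℝ :=
  ∑ ω ∈ Finset.univ.filter (fun ω' => X ω' = x), p ω

/-- Shannon entropy of the random variable `X` under the probability mass function `p`. -/
def H (p : Ω → ℝ) {α : Type*} (X : Ω → α) : ℝ :=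
  -∑ ω, p ω * Real.log (pm p X (X ω))

/-- An `(n = d+1, d)` code: messages `M 1, …, M d`, a key `K`, node contents
`W 1, …, W (d+1)`, and repair data `S i j` (data downloaded from node `i` to repair
node `j`), all random variables on a common finite probability space `(Ω, p)`.
The messages are mutually independent, the key is independent of the messages,
each `W i` is a deterministic function of the messages and the key, and each
`S i j` is a deterministic function of `W i`. -/
structure Code (Ω V : Type) [Fintype Ω] (d : ℕ) : Type where
  p : Ω → ℝ
  p_nonneg : ∀ ω, 0 ≤ p ω
  p_sum : ∑ ω, p ω = 1
  M : ℕ → Ω → V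
  K : Ω → V
  W : ℕ → Ω → V
  S : ℕ → ℕ → Ω → V
  M_indep : ∀ x : ℕ → V,
    pm p (fun ω (i : Fin d) => M (↑i + 1) ω) (fun i => x (↑i + 1)) =
      ∏ i ∈ Finset.Icc 1 d, pm p (M i) (x i)
  K_indep : ∀ (k : V) (x : ℕ → V),
    pm p (fun ω => (K ω, fun (i : Fin d) => M (↑i + 1) ω)) (k, fun i => x (↑i + 1)) =
      pm p K k * pm p (fun ω (i : Fin d) => M (↑i + 1) ω) (fun i => x (↑i + 1))
  W_func : ∀ i ∈ Finset.Icc 1 (d + 1),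
    IsFuncOf (W i) (fun ω => ((fun (j : Fin d) => M (↑j + 1) ω), K ω))
  S_func : ∀ i ∈ Finset.Icc 1 (d + 1), ∀ j ∈ Finset.Icc 1 (d + 1), i ≠ j →
    IsFuncOf (S i j) (W i)

/-- Descriptors for the basic random variables of a code. -/
inductive Atom where
  | M : ℕ → Atom
  | K : Atom
  | W : ℕ → Atom
  | S : ℕ → ℕ → Atom

variable {d : ℕ}

/-- The random variable described by an atom. -/
def Code.atomRV (C : Code Ω V d) : Atom → Ω → V
  | .M i => C.M i
  | .K => C.K
  | .W i => C.W i
  | .S i j => C.S i j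

/-- The joint random variable (tuple) described by a list of atoms. -/
def Code.rv (C : Code Ω V d) (L : List Atom) : Ω → List V :=
  fun ω => L.map fun a => C.atomRV a ω

/-- Joint entropy of a tuple of basic random variables. -/
def Code.HL (C : Code Ω V d) (L : List Atom) : ℝ := H C.p (C.rv L)

/-- Conditional entropy `H(L₁ | L₂)`. -/
def Code.CH (C : Code Ω V d) (L₁ L₂ : List Atom) : ℝ := C.HL (L₁ ++ L₂) - C.HL L₂

/-- Mutual information `I(L₁ ; L₂)`. -/
def Code.MI (C : Code Ω V d) (L₁ L₂ : List Atom) : ℝ :=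
  C.HL L₁ + C.HL L₂ - C.HL (L₁ ++ L₂)

/-- Relabeling of an atom along a permutation of the storage-node indices. -/
def Atom.perm (π : Equiv.Perm ℕ) : Atom → Atom
  | .M i => .M i
  | .K => .K
  | .W i => .W (π i)
  | .S i j => .S (π i) (π j)

/-- A code is symmetrical if every joint entropy of a tuple of the basic random
variables is invariant under every permutation of the storage-node indices `[1:n]`. -/
def Code.Symmetrical (C : Code Ω V d) : Prop :=
  ∀ π : Equiv.Perm ℕ, (∀ i ∈ Finset.Icc 1 (d + 1), π i ∈ Finset.Icc 1 (d + 1)) →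
    ∀ L : List Atom, C.HL (L.map (Atom.perm π)) = C.HL L

/-- The list `[a, a+1, …, b]`. -/
def icc (a b : ℕ) : List ℕ := List.range' a (b + 1 - a)

/-- `W_A` as a list of atoms. -/
def Ws (A : List ℕ) : List Atom := A.map Atom.W

/-- `M_A` as a list of atoms. -/
def MsL (A : List ℕ) : List Atom := A.map Atom.M

/-- `M^{(m)} = (M_1, …, M_m)`. -/
def Mup (m : ℕ) : List Atom := MsL (icc 1 m)

/-- `S_{B → j}`. -/
def Sto (B : List ℕ) (j : ℕ) : List Atom := B.map fun i => Atom.S i j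

/-- `S_{i → B}`. -/
def Sfrom (i : ℕ) (B : List ℕ) : List Atom := B.map fun j => Atom.S i j

/-- `S̄_{→ j} = S_{[j+1:n] → j}` (here `n = d+1`). -/
def SbarTo (d j : ℕ) : List Atom := Sto (icc (j + 1) (d + 1)) j

/-- `S̄_{→ A}`. -/
def SbarToL (d : ℕ) (A : List ℕ) : List Atom := (A.map (SbarTo d)).flatten

/-- `S̲_{→ j} = S_{[1:j-1] → j}`. -/
def SunderTo (j : ℕ) : List Atom := Sto (icc 1 (j - 1)) j

/-- `S̲_{→ A}`. -/
def SunderToL (A : List ℕ) : List Atom := (A.map SunderTo).flatten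

/-- `S_{→ j} = S_{([1:n] ∖ {j}) → j}` (here `n = d+1`). -/
def StoFull (d j : ℕ) : List Atom := Sto ((icc 1 (d + 1)).filter (fun i => i ≠ j)) j

/-- `(S_{→ j} : j ∈ A)`. -/
def StoFullL (d : ℕ) (A : List ℕ) : List Atom := (A.map (StoFull d)).flatten

/-- `U^{(t,s)} = (W_{[1:t]}, S̄_{→[t+1:s]})`. -/
def U (d t s : ℕ) : List Atom := Ws (icc 1 t) ++ SbarToL d (icc (t + 1) s)

/-- Node regeneration: each `W j` is a deterministic function of `S_{→ j}`. -/
def Code.NodeRegen (C : Code Ω V d) : Prop :=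
  ∀ j ∈ Finset.Icc 1 (d + 1), IsFuncOf (C.W j) (C.rv (StoFull d j))

/-- Message recovery for parameter `ℓ`: `M j` is constant for `j ∈ [1:ℓ]`, and for every
`A ⊆ [1:n]` with `|A| ∈ [ℓ+1:d]`, `M_{|A|}` is a deterministic function of `W_A`. -/
def Code.MsgRecovery (C : Code Ω V d) (ℓ : ℕ) : Prop :=
  (∀ j ∈ Finset.Icc 1 ℓ, ∃ c : V, ∀ ω, C.M j ω = c) ∧
  ∀ A : Finset ℕ, A ⊆ Finset.Icc 1 (d + 1) → A.card ∈ Finset.Icc (ℓ + 1) d →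
    IsFuncOf (C.M A.card) (C.rv (Ws (A.sort (· ≤ ·))))

/-- Repair secrecy for parameters `ℓ₁, ℓ₂`: for all disjoint `E₁, E₂ ⊆ [1:n]` with
`|E₁| = ℓ₁`, `|E₂| = ℓ₂`, the messages `M_{ℓ+1}, …, M_d` are independent of
`((W_i : i ∈ E₁), (S_{→j} : j ∈ E₂))`, where `ℓ = ℓ₁ + ℓ₂`. -/
def Code.RepairSecrecy (C : Code Ω V d) (ℓ₁ ℓ₂ : ℕ) : Prop :=
  ∀ E₁ E₂ : Finset ℕ, E₁ ⊆ Finset.Icc 1 (d + 1) → E₂ ⊆ Finset.Icc 1 (d + 1) →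
    Disjoint E₁ E₂ → E₁.card = ℓ₁ → E₂.card = ℓ₂ →
    C.MI (MsL (icc (ℓ₁ + ℓ₂ + 1) d))
      (Ws (E₁.sort (· ≤ ·)) ++ StoFullL d (E₂.sort (· ≤ ·))) = 0

/-- `T_{d,k,ℓ} = Σ_{t=ℓ+1}^{k} (d+1−t)`, as a real number. -/
def T (d k ℓ : ℕ) : ℝ := ∑ t ∈ Finset.Icc (ℓ + 1) k, ((d : ℝ) + 1 - (t : ℝ))

/-! ### Entropy on a finite probability space -/

theorem pm_nonneg {p : Ω → ℝ} (hp : ∀ ω, 0 ≤ p ω) {α : Type*} (X : Ω → α) (x : α) :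
    0 ≤ pm p X x :=
  Finset.sum_nonneg fun ω _ => hp ω

theorem le_pm_self {p : Ω → ℝ} (hp : ∀ ω, 0 ≤ p ω) {α : Type*} (X : Ω → α) (ω : Ω) :
    p ω ≤ pm p X (X ω) :=
  Finset.single_le_sum (f := p) (fun ω' _ => hp ω') (by simp)

/-- Entropy is monotone: if `Y` determines `X`, then `H(X) ≤ H(Y)`. -/
theorem H_le_of_determines {p : Ω → ℝ} (hp : ∀ ω, 0 ≤ p ω) {α β : Type*} {X : Ω → α} {Y : Ω → β}
    (h : ∀ ω ω', Y ω = Y ω' → X ω = X ω') : H p X ≤ H p Y := by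
  refine neg_le_neg (Finset.sum_le_sum fun ω _ => ?_)
  rcases (hp ω).eq_or_lt with h0 | h0
  · simp [← h0]
  · refine mul_le_mul_of_nonneg_left (Real.log_le_log (h0.trans_le (le_pm_self hp Y ω)) ?_) h0.le
    refine Finset.sum_le_sum_of_subset_of_nonneg (fun ω' hω' => ?_) fun ω' _ _ => hp ω'
    simp only [Finset.mem_filter, Finset.mem_univ, true_and] at hω' ⊢
    exact h _ _ hω'

/-- The ratio `P(X) P(Y) / (P(D) P(Z))` has expectation at most one when `(X, Y)` determines `D`
and each of `X`, `Y` determines `Z`. -/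
theorem sum_mul_pm_ratio_le_one {p : Ω → ℝ} (hp : ∀ ω, 0 ≤ p ω) (hp1 : ∑ ω, p ω = 1)
    {α β γ δ : Type*} {X : Ω → α} {Y : Ω → β} {Z : Ω → γ} {D : Ω → δ}
    (hXZ : ∀ ω ω', X ω = X ω' → Z ω = Z ω') (hYZ : ∀ ω ω', Y ω = Y ω' → Z ω = Z ω')
    (hD : ∀ ω ω', X ω = X ω' → Y ω = Y ω' → D ω = D ω') :
    ∑ ω, p ω * (pm p X (X ω) * pm p Y (Y ω) / (pm p D (D ω) * pm p Z (Z ω))) ≤ 1 := by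
  have inner : ∀ ω₁ ω₂, (∑ ω, if X ω₁ = X ω ∧ Y ω₂ = Y ω then
      p ω / (pm p D (D ω) * pm p Z (Z ω)) else 0) ≤
      if Z ω₂ = Z ω₁ then (pm p Z (Z ω₁))⁻¹ else 0 := by
    intro ω₁ ω₂
    by_cases hex : ∃ ω₀, X ω₁ = X ω₀ ∧ Y ω₂ = Y ω₀
    · obtain ⟨ω₀, h1, h2⟩ := hex
      rw [if_pos ((hYZ _ _ h2).trans (hXZ _ _ h1).symm)]
      calc _ ≤ ∑ ω, if D ω = D ω₀ then p ω / (pm p D (D ω₀) * pm p Z (Z ω₁)) else 0 := by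
            refine Finset.sum_le_sum fun ω _ => ?_
            split_ifs with h3 h4 h4
            · rw [h4, hXZ _ _ h3.1]
            · exact absurd (hD _ _ (h3.1.symm.trans h1) (h3.2.symm.trans h2)) h4
            · exact div_nonneg (hp ω) (mul_nonneg (pm_nonneg hp _ _) (pm_nonneg hp _ _))
            · exact le_rfl
        _ = pm p D (D ω₀) / pm p D (D ω₀) * (pm p Z (Z ω₁))⁻¹ := by
            rw [← Finset.sum_filter, ← Finset.sum_div, div_mul_eq_div_div, div_eq_mul_inv]
            rfl
        _ ≤ _ := mul_le_of_le_one_left (inv_nonneg.2 (pm_nonneg hp _ _)) (div_self_le_one _)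
    · push Not at hex
      rw [Finset.sum_eq_zero fun ω _ => if_neg fun h => hex ω h.1 h.2]
      split_ifs
      · exact inv_nonneg.2 (pm_nonneg hp _ _)
      · exact le_rfl
  calc _ = ∑ ω₁, ∑ ω₂, p ω₁ * p ω₂ * (∑ ω, if X ω₁ = X ω ∧ Y ω₂ = Y ω then
      p ω / (pm p D (D ω) * pm p Z (Z ω)) else 0) := by
        simp only [Finset.mul_sum]
        rw [Finset.sum_congr rfl fun ω₁ _ => Finset.sum_comm, Finset.sum_comm]
        refine Finset.sum_congr rfl fun ω _ => ?_
        rw [pm, pm, Finset.sum_filter, Finset.sum_filter, Finset.sum_mul_sum, Finset.sum_div,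
          Finset.mul_sum]
        refine Finset.sum_congr rfl fun ω₁ _ => ?_
        rw [Finset.sum_div, Finset.mul_sum]
        refine Finset.sum_congr rfl fun ω₂ _ => ?_
        by_cases h1 : X ω₁ = X ω <;> by_cases h2 : Y ω₂ = Y ω <;> simp [h1, h2]
        ring
    _ ≤ ∑ ω₁, ∑ ω₂, p ω₁ * p ω₂ * if Z ω₂ = Z ω₁ then (pm p Z (Z ω₁))⁻¹ else 0 :=
        Finset.sum_le_sum fun ω₁ _ => Finset.sum_le_sum fun ω₂ _ =>
          mul_le_mul_of_nonneg_left (inner ω₁ ω₂) (mul_nonneg (hp _) (hp _))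
    _ = ∑ ω₁, p ω₁ * (pm p Z (Z ω₁) / pm p Z (Z ω₁)) := by
        refine Finset.sum_congr rfl fun ω₁ _ => ?_
        rw [div_eq_mul_inv]
        nth_rw 2 [pm]
        rw [Finset.sum_filter, Finset.sum_mul, Finset.mul_sum]
        refine Finset.sum_congr rfl fun ω₂ _ => ?_
        split_ifs <;> ring
    _ ≤ ∑ ω₁, p ω₁ :=
        Finset.sum_le_sum fun ω _ => mul_le_of_le_one_right (hp ω) (div_self_le_one _)
    _ = 1 := hp1

/-- Submodularity of entropy: if `(X, Y)` determines `D` and each of `X`, `Y` determines `Z`, then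
`H(D) + H(Z) ≤ H(X) + H(Y)`. -/
theorem H_add_H_le {p : Ω → ℝ} (hp : ∀ ω, 0 ≤ p ω) (hp1 : ∑ ω, p ω = 1)
    {α β γ δ : Type*} {X : Ω → α} {Y : Ω → β} {Z : Ω → γ} {D : Ω → δ}
    (hXZ : ∀ ω ω', X ω = X ω' → Z ω = Z ω') (hYZ : ∀ ω ω', Y ω = Y ω' → Z ω = Z ω')
    (hD : ∀ ω ω', X ω = X ω' → Y ω = Y ω' → D ω = D ω') :
    H p D + H p Z ≤ H p X + H p Y := by
  have key : ∀ ω, p ω * Real.log (pm p X (X ω)) + p ω * Real.log (pm p Y (Y ω)) -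
      p ω * Real.log (pm p D (D ω)) - p ω * Real.log (pm p Z (Z ω)) ≤
      p ω * (pm p X (X ω) * pm p Y (Y ω) / (pm p D (D ω) * pm p Z (Z ω))) - p ω := by
    intro ω
    rcases (hp ω).eq_or_lt with h0 | h0
    · simp [← h0]
    · have hX := h0.trans_le (le_pm_self hp X ω)
      have hY := h0.trans_le (le_pm_self hp Y ω)
      have hZ := h0.trans_le (le_pm_self hp Z ω)
      have hD := h0.trans_le (le_pm_self hp D ω)
      have := Real.log_le_sub_one_of_pos (div_pos (mul_pos hX hY) (mul_pos hD hZ))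
      rw [Real.log_div (mul_pos hX hY).ne' (mul_pos hD hZ).ne', Real.log_mul hX.ne' hY.ne',
        Real.log_mul hD.ne' hZ.ne'] at this
      linarith [mul_le_mul_of_nonneg_left this h0.le]
  have hsum := Finset.sum_le_sum fun ω (_ : ω ∈ Finset.univ) => key ω
  simp only [Finset.sum_sub_distrib, Finset.sum_add_distrib, hp1] at hsum
  have := sum_mul_pm_ratio_le_one hp hp1 hXZ hYZ hD
  simp only [H]
  linarith

/-! ### Joint entropies of the random variables of a code -/

/-- The values of the tuple `L` determine the values of the tuple `L'`. -/
def Code.Determines (C : Code Ω V d) (L L' : List Atom) : Prop :=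
  ∀ ω ω', (∀ a ∈ L, C.atomRV a ω = C.atomRV a ω') → ∀ a ∈ L', C.atomRV a ω = C.atomRV a ω'

theorem Code.rv_eq_iff (C : Code Ω V d) (L : List Atom) (ω ω' : Ω) :
    C.rv L ω = C.rv L ω' ↔ ∀ a ∈ L, C.atomRV a ω = C.atomRV a ω' :=
  List.map_inj_left

theorem Code.determines_of_subset (C : Code Ω V d) {L L' : List Atom} (h : L' ⊆ L) :
    C.Determines L L' :=
  fun _ _ hL a ha => hL a (h ha)

theorem Code.HL_le (C : Code Ω V d) {L L' : List Atom} (h : C.Determines L L') :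
    C.HL L' ≤ C.HL L :=
  H_le_of_determines C.p_nonneg fun ω ω' e =>
    (C.rv_eq_iff L' ω ω').2 (h ω ω' ((C.rv_eq_iff L ω ω').1 e))

theorem Code.HL_add_HL_le (C : Code Ω V d) {A B D Z : List Atom} (hA : C.Determines A Z)
    (hB : C.Determines B Z) (hD : C.Determines (A ++ B) D) :
    C.HL D + C.HL Z ≤ C.HL A + C.HL B := by
  refine H_add_H_le C.p_nonneg C.p_sum ?_ ?_ ?_ <;> intro ω ω' <;> simp only [C.rv_eq_iff]
  · exact hA ω ω'
  · exact hB ω ω'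
  · exact fun h1 h2 => hD ω ω' fun a ha => (List.mem_append.1 ha).elim (h1 a) (h2 a)

theorem Code.HL_nil (C : Code Ω V d) : C.HL [] = 0 := by
  simp [Code.HL, H, Code.rv, pm, C.p_sum]

theorem Code.HL_append_le (C : Code Ω V d) (A B : List Atom) :
    C.HL (A ++ B) ≤ C.HL A + C.HL B := by
  have := C.HL_add_HL_le (A := A) (B := B) (D := A ++ B) (Z := [])
    (C.determines_of_subset (by simp)) (C.determines_of_subset (by simp))
    (C.determines_of_subset (List.Subset.refl _))
  rwa [C.HL_nil, add_zero] at this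

/-- Adjoining atoms to a tuple `Y` which determines `Z`, where each of the atoms has conditional
entropy at most `h` given `Z`. -/
theorem Code.HL_append_le_add_length_mul (C : Code Ω V d) {Y Z : List Atom} {h : ℝ}
    (hYZ : C.Determines Y Z) (Q : List Atom) (hQ : ∀ a ∈ Q, C.HL (Z ++ [a]) ≤ C.HL Z + h) :
    C.HL (Y ++ Q) ≤ C.HL Y + Q.length * h := by
  induction Q with
  | nil => simp
  | cons a Q ih =>
    have h1 := ih fun b hb => hQ b (List.mem_cons_of_mem _ hb)
    have h2 := hQ a List.mem_cons_self
    have h3 := C.HL_add_HL_le (A := Y ++ Q) (B := Z ++ [a]) (D := Y ++ a :: Q) (Z := Z)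
      (fun ω ω' e => hYZ ω ω' fun b hb => e b (by simp [hb])) (C.determines_of_subset (by simp))
      (C.determines_of_subset fun b => by simp; tauto)
    push_cast [List.length_cons]
    linarith

/-! ### Consequences of the defining properties of a code -/

theorem mem_icc {a b i : ℕ} : i ∈ icc a b ↔ a ≤ i ∧ i ≤ b := by
  simp only [icc, List.mem_range'_1]
  omega

theorem mem_Sto {B : List ℕ} {j : ℕ} {a : Atom} : a ∈ Sto B j ↔ ∃ i ∈ B, a = Atom.S i j := by
  simp [Sto, eq_comm]

theorem mem_U {t s : ℕ} {a : Atom} : a ∈ U d t s ↔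
    (∃ i, (1 ≤ i ∧ i ≤ t) ∧ a = Atom.W i) ∨
      ∃ j, (t + 1 ≤ j ∧ j ≤ s) ∧ ∃ i, (j + 1 ≤ i ∧ i ≤ d + 1) ∧ a = Atom.S i j := by
  simp [U, Ws, SbarToL, SbarTo, mem_Sto, mem_icc, eq_comm]

theorem U_mono {t s s' : ℕ} (h : s ≤ s') : U d t s ⊆ U d t s' := by
  intro a
  simp only [mem_U]
  rintro (h1 | ⟨j, hj, h2⟩)
  · exact Or.inl h1
  · exact Or.inr ⟨j, ⟨hj.1, hj.2.trans h⟩, h2⟩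

/-- A node content is determined once the repair data from all later nodes are known, in addition
to the contents of, or repair data from later nodes for, all earlier nodes. -/
theorem Code.NodeRegen.W_eq {C : Code Ω V d} (hregen : C.NodeRegen) {t s : ℕ} (hs : s ≤ d + 1)
    {ω ω' : Ω} (h : ∀ a ∈ U d t s, C.atomRV a ω = C.atomRV a ω') (j : ℕ) (hj : 1 ≤ j)
    (hjs : j ≤ s ∨ j ≤ t) : C.W j ω = C.W j ω' := by
  induction j using Nat.strong_induction_on with
  | _ j ih =>
    by_cases hjt : j ≤ t
    · exact h (Atom.W j) (mem_U.2 (Or.inl ⟨j, ⟨hj, hjt⟩, rfl⟩))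
    · have hjs' : j ≤ s := by omega
      obtain ⟨f, hf⟩ := hregen j (by simp; omega)
      rw [hf, hf, (C.rv_eq_iff _ ω ω').2]
      intro a ha
      obtain ⟨i, hi, rfl⟩ := mem_Sto.1 ha
      simp only [List.mem_filter, mem_icc, decide_eq_true_eq] at hi
      rcases lt_or_gt_of_ne hi.2 with hij | hij
      · obtain ⟨g, hg⟩ := C.S_func i (by simp; omega) j (by simp; omega) hi.2
        change C.S i j ω = C.S i j ω'
        rw [hg, hg, ih i hij hi.1.1 (by omega)]
      · exact h _ (mem_U.2 (Or.inr ⟨j, by omega, i, by omega, rfl⟩))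

theorem Code.MsgRecovery.M_eq {C : Code Ω V d} {ℓ : ℕ} (hrec : C.MsgRecovery ℓ)
    (hregen : C.NodeRegen) {t s : ℕ} (hs : s ∈ Finset.Icc (ℓ + 1) d)
    {ω ω' : Ω} (h : ∀ a ∈ U d t s, C.atomRV a ω = C.atomRV a ω') : C.M s ω = C.M s ω' := by
  rw [Finset.mem_Icc] at hs
  obtain ⟨f, hf⟩ := hrec.2 (Finset.Icc 1 s) (Finset.Icc_subset_Icc_right (by omega)) (by simp [hs])
  simp only [Nat.card_Icc, Nat.add_sub_cancel] at hf
  rw [hf, hf, (C.rv_eq_iff _ ω ω').2]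
  intro a ha
  simp only [Ws, List.mem_map, Finset.mem_sort, Finset.mem_Icc] at ha
  obtain ⟨i, hi, rfl⟩ := ha
  exact hregen.W_eq (by omega) h i hi.1 (Or.inl hi.2)

theorem Code.Symmetrical.HL_le {C : Code Ω V d} (hsym : C.Symmetrical) {σ : Equiv.Perm ℕ}
    (hσ : ∀ i ∈ Finset.Icc 1 (d + 1), σ i ∈ Finset.Icc 1 (d + 1)) {L L' : List Atom}
    (h : ∀ a ∈ L, a.perm σ ∈ L') : C.HL L ≤ C.HL L' := by
  rw [← hsym σ hσ L]
  refine C.HL_le (C.determines_of_subset fun b hb => ?_)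
  obtain ⟨a, ha, rfl⟩ := List.mem_map.1 hb
  exact h a ha

theorem swap_mem_Icc {a b x y i : ℕ} (hx : a ≤ x ∧ x ≤ b) (hy : a ≤ y ∧ y ≤ b)
    (hi : a ≤ i ∧ i ≤ b) : a ≤ Equiv.swap x y i ∧ Equiv.swap x y i ≤ b := by
  rw [Equiv.swap_apply_def]
  split_ifs <;> assumption

theorem swap_mem_U {t s x y : ℕ} (hts : t ≤ s) (hx : s < x ∧ x ≤ d + 1) (hy : s < y ∧ y ≤ d + 1)
    {a : Atom} (ha : a ∈ U d t s) : a.perm (Equiv.swap x y) ∈ U d t s := by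
  rcases mem_U.1 ha with ⟨i, hi, rfl⟩ | ⟨j, hj, i, hi, rfl⟩
  · rw [Atom.perm, Equiv.swap_apply_of_ne_of_ne (by omega) (by omega)]
    exact ha
  · rw [Atom.perm, Equiv.swap_apply_of_ne_of_ne (a := x) (b := y) (x := j) (by omega) (by omega)]
    exact mem_U.2 (Or.inr ⟨j, hj, _, swap_mem_Icc (by omega) (by omega) hi, rfl⟩)

theorem perm_mem_MsL {A : List ℕ} {a : Atom} (σ : Equiv.Perm ℕ) (ha : a ∈ MsL A) :
    a.perm σ ∈ MsL A := by
  obtain ⟨i, hi, rfl⟩ := List.mem_map.1 ha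
  exact ha

/-- The normalized increments of `s ↦ H(U^{(t,s)}, M_A)` are antitone. -/
theorem Code.mul_HL_U_increment_le {C : Code Ω V d} (hsym : C.Symmetrical)
    (hregen : C.NodeRegen) (A : List ℕ) {t s : ℕ} (hts : t ≤ s) (hs : s + 2 ≤ d) :
    ((d : ℝ) - s) * (C.HL (U d t (s + 2) ++ MsL A) - C.HL (U d t (s + 1) ++ MsL A)) ≤
      ((d : ℝ) - (s + 1)) * (C.HL (U d t (s + 1) ++ MsL A) - C.HL (U d t s ++ MsL A)) := by
  set Z := U d t s ++ MsL A with hZ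
  set Y := U d t (s + 1) ++ MsL A with hY
  set Q := Sto (icc (s + 3) (d + 1)) (s + 2) with hQ
  have hZY : Z ⊆ Y := by
    intro a
    simp only [hZ, hY, List.mem_append]
    exact Or.imp_left fun h => U_mono (Nat.le_succ s) h
  have hswap : ∀ {x y : ℕ}, s < x ∧ x ≤ d + 1 → s < y ∧ y ≤ d + 1 → ∀ {a : Atom}, a ∈ Z →
      a.perm (Equiv.swap x y) ∈ Z := by
    intro x y hx hy a ha
    rcases List.mem_append.1 ha with ha | ha
    · exact List.mem_append_left _ (swap_mem_U hts hx hy ha)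
    · exact List.mem_append_right _ (perm_mem_MsL _ ha)
  have hIcc : ∀ {x y : ℕ}, s < x ∧ x ≤ d + 1 → s < y ∧ y ≤ d + 1 →
      ∀ i ∈ Finset.Icc 1 (d + 1), Equiv.swap x y i ∈ Finset.Icc 1 (d + 1) := by
    intro x y hx hy i hi
    rw [Finset.mem_Icc] at hi ⊢
    exact swap_mem_Icc (by omega) (by omega) hi
  -- Exchange the nodes `s + 1` and `s + 2`.
  have hP : C.HL (Z ++ Atom.S (s + 1) (s + 2) :: Q) ≤ C.HL Y := by
    refine hsym.HL_le (hIcc (x := s + 1) (y := s + 2) (by omega) (by omega)) fun a ha => ?_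
    have hnew : ∀ i, s + 2 ≤ i → i ≤ d + 1 → Atom.S i (s + 1) ∈ Y := fun i h1 h2 =>
      List.mem_append_left _ (mem_U.2 (Or.inr ⟨s + 1, by omega, i, by omega, rfl⟩))
    rcases List.mem_append.1 ha with ha | ha
    · exact hZY (hswap (by omega) (by omega) ha)
    · rcases List.mem_cons.1 ha with rfl | ha
      · simpa [Atom.perm] using hnew (s + 2) le_rfl (by omega)
      · obtain ⟨i, hi, rfl⟩ := mem_Sto.1 ha
        rw [mem_icc] at hi
        rw [Atom.perm, Equiv.swap_apply_right,
          Equiv.swap_apply_of_ne_of_ne (a := s + 1) (x := i) (by omega) (by omega)]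
        exact hnew i (by omega) hi.2
  -- Each single piece of new repair data has the same conditional entropy given `Z`.
  have hone : ∀ a ∈ Q, C.HL (Z ++ [a]) ≤
      C.HL Z + (C.HL (Z ++ [Atom.S (s + 1) (s + 2)]) - C.HL Z) := by
    intro a ha
    obtain ⟨i, hi, rfl⟩ := mem_Sto.1 ha
    rw [mem_icc] at hi
    rw [add_sub_cancel]
    refine hsym.HL_le (hIcc (x := s + 1) (y := i) (by omega) (by omega)) fun a ha => ?_
    rcases List.mem_append.1 ha with ha | ha
    · exact List.mem_append_left _ (hswap (by omega) (by omega) ha)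
    · rw [List.mem_singleton.1 ha, Atom.perm, Equiv.swap_apply_right,
        Equiv.swap_apply_of_ne_of_ne (a := s + 1) (x := s + 2) (by omega) (by omega)]
      simp
  have hsplit : ∀ b ∈ U d t (s + 2) ++ MsL A, b ∈ Y ∨ b ∈ Q := by
    intro b hb
    rcases List.mem_append.1 hb with hb | hb
    · rcases mem_U.1 hb with ⟨i, hi, rfl⟩ | ⟨j, hj, i, hi, rfl⟩
      · exact Or.inl (List.mem_append_left _ (mem_U.2 (Or.inl ⟨i, hi, rfl⟩)))
      · by_cases hjs : j ≤ s + 1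
        · exact Or.inl (List.mem_append_left _
            (mem_U.2 (Or.inr ⟨j, ⟨hj.1, hjs⟩, i, hi, rfl⟩)))
        · obtain rfl : j = s + 2 := by omega
          exact Or.inr (mem_Sto.2 ⟨i, mem_icc.2 hi, rfl⟩)
    · exact Or.inl (List.mem_append_right _ hb)
  have hunion : C.HL (U d t (s + 2) ++ MsL A) ≤
      C.HL Y + Q.length * (C.HL (Z ++ [Atom.S (s + 1) (s + 2)]) - C.HL Z) :=
    (C.HL_le (C.determines_of_subset fun b hb => List.mem_append.2 (hsplit b hb))).trans
      (C.HL_append_le_add_length_mul (C.determines_of_subset hZY) Q hone)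
  have hsub : C.HL (U d t (s + 2) ++ MsL A) + C.HL (Z ++ [Atom.S (s + 1) (s + 2)]) ≤
      C.HL (Z ++ Atom.S (s + 1) (s + 2) :: Q) + C.HL Y := by
    refine C.HL_add_HL_le (C.determines_of_subset fun b => by simp; tauto) ?_
      (C.determines_of_subset fun b hb => ?_)
    · intro ω ω' h a ha
      rcases List.mem_append.1 ha with ha | ha
      · exact h a (hZY ha)
      · rw [List.mem_singleton.1 ha]
        obtain ⟨g, hg⟩ := C.S_func (s + 1) (by simp; omega) (s + 2) (by simp; omega) (by omega)
        change C.S _ _ ω = C.S _ _ ω'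
        rw [hg, hg, hregen.W_eq (t := t) (s := s + 1) (by omega)
          (fun b hb => h b (List.mem_append_left _ hb)) (s + 1) (by omega) (Or.inl le_rfl)]
    · rcases hsplit b hb with hb | hb <;> simp [hb]
  have hlen : (Q.length : ℝ) = (d : ℝ) - (s + 1) := by
    have : Q.length + (s + 1) = d := by simp [hQ, Sto, icc]; omega
    rw [← this]
    push_cast
    ring
  rw [hlen] at hunion
  have hpos : (0 : ℝ) ≤ (d : ℝ) - (s + 1) := by
    have : ((s + 2 : ℕ) : ℝ) ≤ d := by exact_mod_cast hs
    push_cast at this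
    linarith
  nlinarith [mul_le_mul_of_nonneg_left (hsub.trans (add_le_add_left hP _)) hpos]

theorem T_succ {k ℓ : ℕ} (hk : ℓ ≤ k) : T d (k + 1) ℓ = T d k ℓ + ((d : ℝ) - k) := by
  rw [T, Finset.sum_Icc_succ_top (by omega), T]
  push_cast
  ring

theorem T_self (ℓ : ℕ) : T d ℓ ℓ = 0 := by
  simp [T]

theorem T_pos {k ℓ : ℕ} (hk : ℓ < k) (hkd : k ≤ d) : 0 < T d k ℓ := by
  refine Finset.sum_pos (fun t ht => ?_) ⟨k, by simp; omega⟩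
  have : (t : ℝ) ≤ d := by exact_mod_cast (Finset.mem_Icc.1 ht).2.trans hkd
  linarith

theorem Code.T_mul_HL_U_increment_le {C : Code Ω V d} (hsym : C.Symmetrical)
    (hregen : C.NodeRegen) (A : List ℕ) {t ℓ m : ℕ} (ht : t ≤ ℓ) (hm : ℓ ≤ m) (hmd : m < d) :
    T d m ℓ * (C.HL (U d t (m + 1) ++ MsL A) - C.HL (U d t m ++ MsL A)) ≤
      ((d : ℝ) - m) * (C.HL (U d t m ++ MsL A) - C.HL (U d t ℓ ++ MsL A)) := by
  induction m, hm using Nat.le_induction with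
  | base => simp [T_self]
  | succ k hk ih =>
    have h1 := ih (by omega)
    have h2 := C.mul_HL_U_increment_le hsym hregen A (ht.trans hk) hmd
    rw [T_succ hk]
    have hdk : (0 : ℝ) < (d : ℝ) - (k + 1) := by
      have : ((k + 1 : ℕ) : ℝ) < d := by exact_mod_cast hmd
      push_cast at this
      linarith
    have hT : 0 ≤ T d k ℓ := by
      rcases hk.eq_or_lt with rfl | hk
      · rw [T_self]
      · exact (T_pos hk (by omega)).le
    have h3 := mul_le_mul_of_nonneg_left h2 hT
    have h4 := mul_le_mul_of_nonneg_left h1 hdk.le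
    have hdk' : (0 : ℝ) < (d : ℝ) - k := by linarith
    push_cast
    refine le_of_mul_le_mul_left ?_ hdk'
    linarith [mul_le_mul_of_nonneg_left h2 hdk'.le]

/-- Independence of the messages, in terms of entropies. -/
theorem Code.HL_messages (C : Code Ω V d) :
    C.HL (MsL (icc 1 d)) = ∑ i ∈ Finset.Icc 1 d, C.HL [Atom.M i] := by
  have htuple : ∀ ω, pm C.p (C.rv (MsL (icc 1 d))) (C.rv (MsL (icc 1 d)) ω) =
      ∏ i ∈ Finset.Icc 1 d, pm C.p (C.rv [Atom.M i]) (C.rv [Atom.M i] ω) := by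
    intro ω
    have h := C.M_indep fun i => C.M i ω
    have hL : pm C.p (C.rv (MsL (icc 1 d))) (C.rv (MsL (icc 1 d)) ω) =
        pm C.p (fun ω (i : Fin d) => C.M (↑i + 1) ω) (fun i => C.M (↑i + 1) ω) := by
      unfold pm
      congr 1
      ext ω'
      simp only [Finset.mem_filter, Finset.mem_univ, true_and, C.rv_eq_iff, MsL, List.mem_map,
        mem_icc, funext_iff]
      constructor
      · exact fun h i => h (Atom.M (i + 1)) ⟨i + 1, by omega, rfl⟩
      · rintro h a ⟨i, hi, rfl⟩
        have := h ⟨i - 1, by omega⟩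
        simp only [Nat.sub_add_cancel hi.1] at this
        exact this
    rw [hL, h]
    refine Finset.prod_congr rfl fun i _ => ?_
    unfold pm
    congr 1
    ext ω'
    simp [C.rv_eq_iff, Code.atomRV]
  simp only [Code.HL, H, Finset.sum_neg_distrib]
  rw [Finset.sum_comm, neg_inj]
  refine Finset.sum_congr rfl fun ω _ => ?_
  rcases (C.p_nonneg ω).eq_or_lt with h0 | h0
  · simp [← h0]
  · rw [htuple, Real.log_prod fun i _ => (h0.trans_le (le_pm_self C.p_nonneg _ ω)).ne',
      Finset.mul_sum]

theorem Code.HL_MsL_toList_le (C : Code Ω V d) (s : Finset ℕ) :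
    C.HL (MsL s.toList) ≤ ∑ i ∈ s, C.HL [Atom.M i] := by
  rw [← Finset.sum_map_toList]
  generalize s.toList = L
  induction L with
  | nil => exact C.HL_nil.le
  | cons i L ih => exact (C.HL_append_le [Atom.M i] (MsL L)).trans (by simpa using ih)

theorem Code.HL_MsL_icc (C : Code Ω V d) {a b : ℕ} (ha : 1 ≤ a) (hb : b ≤ d) :
    C.HL (MsL (icc a b)) = ∑ i ∈ Finset.Icc a b, C.HL [Atom.M i] := by
  refine le_antisymm (le_trans (C.HL_le (C.determines_of_subset ?_))
    (C.HL_MsL_toList_le (Finset.Icc a b))) ?_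
  · exact List.map_subset _ fun i => by simp [mem_icc]
  · have h1 := C.HL_append_le (MsL (icc a b)) (MsL (Finset.Icc 1 d \ Finset.Icc a b).toList)
    have h2 : C.HL (MsL (icc 1 d)) ≤ _ := C.HL_le (L := MsL (icc a b) ++
        MsL (Finset.Icc 1 d \ Finset.Icc a b).toList) (C.determines_of_subset (by
      rw [MsL, MsL, MsL, ← List.map_append]
      refine List.map_subset _ fun i => ?_
      simp only [mem_icc, List.mem_append, Finset.mem_toList, Finset.mem_sdiff, Finset.mem_Icc]
      tauto))
    have h3 := C.HL_MsL_toList_le (Finset.Icc 1 d \ Finset.Icc a b)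
    rw [C.HL_messages,
      ← Finset.sum_sdiff (Finset.Icc_subset_Icc ha hb : Finset.Icc a b ⊆ Finset.Icc 1 d)] at h2
    linarith

/-- Repair secrecy: the messages are independent of `U^{(ℓ₁,ℓ₁+ℓ₂)}`. -/
theorem Code.RepairSecrecy.HL_add_le {C : Code Ω V d} {ℓ₁ ℓ₂ : ℕ} (hsec : C.RepairSecrecy ℓ₁ ℓ₂)
    (hℓ : ℓ₁ + ℓ₂ ≤ d) {m : ℕ} (hm : m ≤ d) :
    C.HL (U d ℓ₁ (ℓ₁ + ℓ₂)) + C.HL (MsL (icc (ℓ₁ + ℓ₂ + 1) m)) ≤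
      C.HL (U d ℓ₁ (ℓ₁ + ℓ₂) ++ MsL (icc (ℓ₁ + ℓ₂ + 1) m)) := by
  have h := hsec (Finset.Icc 1 ℓ₁) (Finset.Icc (ℓ₁ + 1) (ℓ₁ + ℓ₂))
    (Finset.Icc_subset_Icc_right (by omega)) (Finset.Icc_subset_Icc (by omega) (by omega))
    (Finset.disjoint_left.2 fun i => by simp only [Finset.mem_Icc]; omega) (by simp) (by simp)
  set E := Ws ((Finset.Icc 1 ℓ₁).sort (· ≤ ·)) ++
    StoFullL d ((Finset.Icc (ℓ₁ + 1) (ℓ₁ + ℓ₂)).sort (· ≤ ·)) with hE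
  set N := MsL (icc (ℓ₁ + ℓ₂ + 1) m)
  set N' := MsL (icc (ℓ₁ + ℓ₂ + 1) d)
  have hN : N ⊆ N' := List.map_subset _ fun i => by simp only [mem_icc]; omega
  have hU : U d ℓ₁ (ℓ₁ + ℓ₂) ⊆ E := by
    intro a ha
    rcases mem_U.1 ha with ⟨i, hi, rfl⟩ | ⟨j, hj, i, hi, rfl⟩
    · exact List.mem_append_left _ (List.mem_map.2 ⟨i, by simpa using hi, rfl⟩)
    · refine List.mem_append_right _ (List.mem_flatten.2 ⟨StoFull d j,
        List.mem_map.2 ⟨j, by simpa using hj, rfl⟩, mem_Sto.2 ⟨i, ?_, rfl⟩⟩)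
      simp only [List.mem_filter, mem_icc, decide_eq_true_eq]
      omega
  have h1 : C.HL (N' ++ E) + C.HL N ≤ C.HL (N ++ E) + C.HL N' :=
    C.HL_add_HL_le (C.determines_of_subset (by simp)) (C.determines_of_subset hN)
      (C.determines_of_subset fun a => by simp; tauto)
  have h2 : C.HL (N ++ E) + C.HL (U d ℓ₁ (ℓ₁ + ℓ₂)) ≤
      C.HL (U d ℓ₁ (ℓ₁ + ℓ₂) ++ N) + C.HL E :=
    C.HL_add_HL_le (C.determines_of_subset (by simp)) (C.determines_of_subset hU)
      (C.determines_of_subset fun a => by simp; tauto)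
  rw [Code.MI] at h
  linarith

/-- Conditioning on one more message, when passing from `U^{(t,m)}` to `U^{(t,m+1)}`. -/
theorem Code.HL_add_CH_U_succ_le {C : Code Ω V d} {ℓ : ℕ} (hregen : C.NodeRegen)
    (hrec : C.MsgRecovery ℓ) (t : ℕ) {m : ℕ} (hm : ℓ ≤ m) (hmd : m < d) :
    C.HL [Atom.M (m + 1)] + C.CH (U d t (m + 1)) (MsL (icc (ℓ + 1) (m + 1))) ≤
      C.CH (U d t (m + 1)) (MsL (icc (ℓ + 1) m)) := by
  have h1 : C.HL (U d t (m + 1) ++ MsL (icc (ℓ + 1) (m + 1))) ≤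
      C.HL (U d t (m + 1) ++ MsL (icc (ℓ + 1) m)) := by
    refine C.HL_le fun ω ω' h a ha => ?_
    rcases List.mem_append.1 ha with ha | ha
    · exact h a (List.mem_append_left _ ha)
    · obtain ⟨i, hi, rfl⟩ := List.mem_map.1 ha
      rw [mem_icc] at hi
      by_cases him : i ≤ m
      · exact h _ (List.mem_append_right _ (List.mem_map.2 ⟨i, mem_icc.2 ⟨hi.1, him⟩, rfl⟩))
      · obtain rfl : i = m + 1 := by omega
        exact hrec.M_eq hregen (Finset.mem_Icc.2 ⟨hi.1, hmd⟩)
          fun b hb => h b (List.mem_append_left _ hb)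
  rw [Code.CH, Code.CH, C.HL_MsL_icc (by omega) hmd, C.HL_MsL_icc (by omega) hmd.le,
    Finset.sum_Icc_succ_top (by omega)]
  linarith

theorem statement10 {Ω V : Type} [Fintype Ω] {d : ℕ} (hd : 2 ≤ d)
    {ℓ₁ ℓ₂ ℓ : ℕ} (hℓdef : ℓ = ℓ₁ + ℓ₂) (hℓd : ℓ < d)
    (C : Code Ω V d) (hsym : C.Symmetrical) (hregen : C.NodeRegen)
    (hrec : C.MsgRecovery ℓ) (hsec : C.RepairSecrecy ℓ₁ ℓ₂)
    {m : ℕ} (hm : m ∈ Finset.Icc (ℓ + 1) d) :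
    1 / ((d : ℝ) - (ℓ : ℝ)) * C.HL (U d ℓ₁ (ℓ + 1))
      ≥ (∑ j ∈ Finset.Icc (ℓ + 1) m, (T d j ℓ)⁻¹ * C.HL [Atom.M j])
        + (T d m ℓ)⁻¹ * C.CH (U d ℓ₁ m) (MsL (icc (ℓ + 1) m))
        + (1 / ((d : ℝ) - (ℓ : ℝ)) - (T d m ℓ)⁻¹) * C.HL (U d ℓ₁ ℓ) := by
  rw [Finset.mem_Icc] at hm
  obtain ⟨hm, hmd⟩ := hm
  have hTℓ : T d (ℓ + 1) ℓ = (d : ℝ) - ℓ := by rw [T_succ le_rfl, T_self, zero_add]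
  induction m, hm using Nat.le_induction with
  | base =>
    have h := C.HL_add_CH_U_succ_le hregen hrec ℓ₁ le_rfl hℓd
    have hnil : MsL (icc (ℓ + 1) ℓ) = [] := by simp [MsL, icc]
    have hCH : C.CH (U d ℓ₁ (ℓ + 1)) [] = C.HL (U d ℓ₁ (ℓ + 1)) := by simp [Code.CH, C.HL_nil]
    rw [hnil, hCH] at h
    have hpos := inv_nonneg.2 (T_pos (d := d) (Nat.lt_succ_self ℓ) hℓd).le
    rw [hTℓ] at hpos
    rw [Finset.Icc_self, Finset.sum_singleton, hTℓ, one_div]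
    linarith [mul_le_mul_of_nonneg_left h hpos]
  | succ m hm ih =>
    have ih := ih (by omega)
    have hstep := C.HL_add_CH_U_succ_le hregen hrec ℓ₁ (m := m) (by omega) (by omega)
    have hinc := C.T_mul_HL_U_increment_le hsym hregen (icc (ℓ + 1) m) (t := ℓ₁) (ℓ := ℓ) (m := m)
      (by omega) (by omega) (by omega)
    have hsecr := hsec.HL_add_le (m := m) (by omega) (by omega)
    rw [← hℓdef] at hsecr
    have hT := T_pos (d := d) (k := m) (ℓ := ℓ) (by omega) (by omega)
    have hT' := T_pos (d := d) (k := m + 1) (ℓ := ℓ) (by omega) (by omega)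
    have hTs : T d (m + 1) ℓ = T d m ℓ + ((d : ℝ) - m) := T_succ (by omega)
    have hdm : (0 : ℝ) ≤ (d : ℝ) - m := sub_nonneg.2 (by exact_mod_cast (by omega : m ≤ d))
    rw [Finset.sum_Icc_succ_top (by omega)]
    simp only [Code.CH] at ih hstep ⊢
    set b := C.HL [Atom.M (m + 1)]
    set u := C.HL (U d ℓ₁ ℓ)
    set v := C.HL (MsL (icc (ℓ + 1) m))
    set f := C.HL (U d ℓ₁ m ++ MsL (icc (ℓ + 1) m))
    set g := C.HL (U d ℓ₁ (m + 1) ++ MsL (icc (ℓ + 1) m))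
    have h1 : T d m ℓ * (g - v - u) ≤ T d (m + 1) ℓ * (f - v - u) := by
      rw [hTs]
      linarith [mul_le_mul_of_nonneg_left hsecr hdm]
    have h2 : (T d (m + 1) ℓ)⁻¹ * (g - v - u) ≤ (T d m ℓ)⁻¹ * (f - v - u) := by
      rw [inv_mul_eq_div, inv_mul_eq_div, div_le_div_iff₀ hT' hT]
      linarith
    linarith [mul_le_mul_of_nonneg_left hstep (inv_nonneg.2 hT'.le)]

end

end MDCSR
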